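/- Let G be a connected Δ-regular finite simple graph of order n with Δ ≥ 3 satisfying (Δ−1)·Z(G) = (Δ−2)·n + 2. Let S be a zero forcing set of G of minimum cardinality among all zero forcing sets whose complement induces a connected subgraph, and let S̄ = V(G)∖S, so that G[S̄] is a tree and every vertex of S has exactly one neighbor in S̄. Let x be a leaf of the tree G[S̄] with |S̄| ≥ 2, and let X = N(x) ∩ S. Then X is either an independent set of G or a clique of G. -/

import Mathlib

/-- The zero forcing closure: `v` eventually becomes colored starting from `S`,
under the rule that a colored vertex all of whose other neighbors are colored
forces its remaining neighbor to become colored. -/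
inductive SimpleGraph.ZeroForces {V : Type*} (G : SimpleGraph V) (S : Set V) : V → Prop
  | init {v : V} (hv : v ∈ S) : SimpleGraph.ZeroForces G S v
  | force {u w : V} (hu : SimpleGraph.ZeroForces G S u) (hadj : G.Adj u w)
      (hall : ∀ v, G.Adj u v → v ≠ w → SimpleGraph.ZeroForces G S v) :
      SimpleGraph.ZeroForces G S w

/-- `S` is a zero forcing set of `G` if every vertex eventually becomes colored. -/
def SimpleGraph.IsZeroForcingSet {V : Type*} (G : SimpleGraph V) (S : Set V) : Prop :=
  ∀ v, G.ZeroForces S v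

/-- The zero forcing number of `G`: minimum cardinality of a zero forcing set. -/
noncomputable def SimpleGraph.zeroForcingNumber {V : Type*} (G : SimpleGraph V) : ℕ :=
  sInf {n | ∃ S : Set V, G.IsZeroForcingSet S ∧ S.ncard = n}

namespace SimpleGraph

variable {V : Type*} {G : SimpleGraph V}

theorem ZeroForces.trans {S T : Set V} (hST : ∀ s ∈ S, G.ZeroForces T s) {v : V}
    (hv : G.ZeroForces S v) : G.ZeroForces T v := by
  induction hv with
  | init hv => exact hST _ hv
  | force _ hadj _ hu hall => exact .force hu hadj hall

theorem IsZeroForcingSet.zeroForcingNumber_le {S : Set V} (hS : G.IsZeroForcingSet S) :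
    G.zeroForcingNumber ≤ S.ncard :=
  Nat.sInf_le ⟨S, hS, rfl⟩

/-- If `u`, `w ∈ S` are such that `x` is their only neighbor outside `S`, with `v` adjacent to `u`
but not to `w`, then `v` can be removed from a zero forcing set `S`: the vertex `w` forces `x`,
and then `u` forces `v`. -/
theorem IsZeroForcingSet.sdiff_singleton {S : Set V} (hS : G.IsZeroForcingSet S) {u v w x : V}
    (hu : u ∈ S) (hw : w ∈ S) (hux : ∀ z, G.Adj u z → z ∉ S → z = x)
    (hwx : ∀ z, G.Adj w z → z ∉ S → z = x) (hwx' : G.Adj w x) (huv : G.Adj u v)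
    (hwv : ¬ G.Adj w v) (hne : w ≠ v) : G.IsZeroForcingSet (S \ {v}) := by
  have hx : G.ZeroForces (S \ {v}) x := by
    refine .force (.init ⟨hw, hne⟩) hwx' fun z hz hzx => .init ⟨?_, ?_⟩
    · by_contra h
      exact hzx (hwx z hz h)
    · rintro rfl
      exact hwv hz
  have hv : G.ZeroForces (S \ {v}) v := by
    refine .force (.init ⟨hu, huv.ne⟩) huv fun z hz hzv => ?_
    by_cases hzS : z ∈ S
    · exact .init ⟨hzS, hzv⟩
    · rwa [hux z hz hzS]
  refine fun z => ZeroForces.trans (fun s hs => ?_) (hS z)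
  obtain rfl | hsv := eq_or_ne s v
  · exact hv
  · exact .init ⟨hs, hsv⟩

/-- In a `Δ`-regular graph, count the edges between `S` and its complement when the latter induces
a tree and every vertex of `S` has exactly one neighbor in it. -/
theorem IsRegularOfDegree.mul_ncard_compl_add_two [Fintype V] [DecidableRel G.Adj] {Δ : ℕ}
    (hreg : G.IsRegularOfDegree Δ) {S : Set V} (htree : (G.induce Sᶜ).IsTree)
    (hone : ∀ v ∈ S, {w : V | w ∈ Sᶜ ∧ G.Adj v w}.ncard = 1) :
    Δ * Sᶜ.ncard + 2 = 2 * Sᶜ.ncard + S.ncard := by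
  classical
  have hedges := htree.card_edgeFinset
  have hsum := (G.induce Sᶜ).sum_degrees_eq_twice_card_edges
  have hdeg (v : (Sᶜ : Set V)) : (G.induce Sᶜ).degree v
      + (S.toFinset.bipartiteAbove G.Adj (v : V)).card = Δ := by
    rw [← hreg v, ← card_neighborFinset_eq_degree, ← card_neighborFinset_eq_degree,
      ← Finset.card_map (Function.Embedding.subtype _), ← Finset.card_union_of_disjoint]
    · congr 1
      ext w
      simp only [Finset.mem_union, Finset.mem_map, Finset.mem_bipartiteAbove, mem_neighborFinset,
        Set.mem_toFinset]
      constructor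
      · rintro (⟨z, hz, rfl⟩ | h)
        · exact hz
        · exact h.2
      · intro h
        by_cases hw : w ∈ S
        · exact .inr ⟨hw, h⟩
        · exact .inl ⟨⟨w, hw⟩, h, rfl⟩
    · rw [Finset.disjoint_left]
      rintro w hw hw'
      obtain ⟨z, -, rfl⟩ := Finset.mem_map.1 hw
      exact z.2 (Set.mem_toFinset.1 ((Finset.mem_bipartiteAbove _).1 hw').1)
  have hbelow : ∀ w ∈ S.toFinset, ((Sᶜ).toFinset.bipartiteBelow G.Adj w).card = 1 := by
    intro w hw
    rw [← hone w (Set.mem_toFinset.1 hw), ← Set.ncard_coe_finset]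
    congr 1
    ext z
    simp [Finset.bipartiteBelow, adj_comm]
  have hcross := Finset.sum_card_bipartiteAbove_eq_sum_card_bipartiteBelow
    (s := (Sᶜ).toFinset) (t := S.toFinset) G.Adj
  rw [Finset.sum_congr rfl hbelow, Finset.sum_const, smul_eq_mul, mul_one,
    ← Set.ncard_eq_toFinset_card'] at hcross
  have hcoe : ∑ v : (Sᶜ : Set V), (S.toFinset.bipartiteAbove G.Adj (v : V)).card = S.ncard := by
    rw [← hcross]
    exact (Finset.sum_subtype _ (fun _ => Set.mem_toFinset)
      fun v => (S.toFinset.bipartiteAbove G.Adj v).card).symm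
  have htotal := Finset.sum_congr (rfl : (Finset.univ : Finset (Sᶜ : Set V)) = _)
    fun v _ => hdeg v
  rw [Finset.sum_add_distrib, hsum, hcoe, Finset.sum_const, smul_eq_mul, Finset.card_univ]
    at htotal
  rw [← Nat.card_eq_fintype_card, Nat.card_coe_set_eq] at hedges htotal
  linarith

end SimpleGraph

/-- With `G[S̄]` a tree, every vertex of `S` having exactly one
neighbor in `S̄`, `|S̄| ≥ 2`, and `x` a leaf of `G[S̄]`, the set `X = N(x) ∩ S`
is either an independent set of `G` or a clique of `G`. -/
theorem stmt10 {V : Type*} [Fintype V] (G : SimpleGraph V) [DecidableRel G.Adj]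
    (n Δ : ℕ) (hn : Fintype.card V = n) (hΔ3 : 3 ≤ Δ)
    (hreg : G.IsRegularOfDegree Δ) (hconn : G.Connected)
    (hZ : (Δ - 1) * G.zeroForcingNumber = (Δ - 2) * n + 2)
    (S : Set V) (hzf : G.IsZeroForcingSet S)
    (hSc : (G.induce Sᶜ).Connected)
    (hmin : ∀ T : Set V, G.IsZeroForcingSet T → (G.induce Tᶜ).Connected →
      S.ncard ≤ T.ncard)
    (htree : (G.induce Sᶜ).IsTree)
    (hone : ∀ v ∈ S, {w : V | w ∈ Sᶜ ∧ G.Adj v w}.ncard = 1)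
    (hcard2 : 2 ≤ (Sᶜ : Set V).ncard)
    (x : V) (hx : x ∈ Sᶜ) (hleaf : {w : V | w ∈ Sᶜ ∧ G.Adj x w}.ncard = 1) :
    (∀ a ∈ G.neighborSet x ∩ S, ∀ b ∈ G.neighborSet x ∩ S, ¬ G.Adj a b) ∨
      (∀ a ∈ G.neighborSet x ∩ S, ∀ b ∈ G.neighborSet x ∩ S, a ≠ b → G.Adj a b) := by
  have hS : S.ncard ≤ G.zeroForcingNumber := by
    have hcount := hreg.mul_ncard_compl_add_two htree hone
    have hcard := Set.ncard_add_ncard_compl S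
    rw [Nat.card_eq_fintype_card, hn] at hcard
    obtain ⟨d, rfl⟩ := Nat.exists_eq_add_of_le hΔ3
    rw [show 3 + d - 1 = d + 2 by omega, show 3 + d - 2 = d + 1 by omega, ← hcard] at hZ
    exact Nat.le_of_mul_le_mul_left (by linarith : (d + 2) * _ ≤ (d + 2) * _) (by omega)
  have hunique : ∀ a ∈ G.neighborSet x ∩ S, ∀ z, G.Adj a z → z ∉ S → z = x := by
    intro a ha z hz hzS
    obtain ⟨y, hy⟩ := Set.ncard_eq_one.1 (hone a ha.2)
    have hxy : x ∈ ({y} : Set V) := hy ▸ ⟨hx, ha.1.symm⟩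
    have hzy : z ∈ ({y} : Set V) := hy ▸ ⟨hzS, hz⟩
    exact hzy.trans hxy.symm
  have huniv : ∀ u ∈ G.neighborSet x ∩ S, ∀ v ∈ G.neighborSet x ∩ S, G.Adj u v →
      ∀ w ∈ G.neighborSet x ∩ S, w ≠ v → G.Adj w v := by
    intro u hu v hv huv w hw hne
    by_contra hwv
    have hle := (hzf.sdiff_singleton hu.2 hw.2 (hunique u hu) (hunique w hw) hw.1.symm huv hwv
      hne).zeroForcingNumber_le
    have hlt := Set.ncard_sdiff_singleton_lt_of_mem hv.2
    omega
  by_contra! h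
  obtain ⟨⟨a, ha, b, hb, hab⟩, c, hc, d, hd, hcd, hnadj⟩ := h
  obtain rfl | hca := eq_or_ne c a
  · exact hnadj (huniv b hb c hc hab.symm d hd hcd.symm).symm
  · exact hnadj (huniv a ha c hc (huniv b hb a ha hab.symm c hc hca).symm d hd hcd.symm).symm
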